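/- arXiv:2408.15960 — 6 statements merged into one kernel-verified Lean document; each statement's English description precedes it below -/
import Mathlib

section
/- Let R be the fusion ring of Rep(D₈) with dimension homomorphism d, and let δ be the associated differential. If n : R × R → ℤ is ℤ-bilinear and satisfies δn = 0 (i.e. n is a 2-cocycle), then for every a ∈ ℤ/2 × ℤ/2 one has n(e_a, e_D) = n(e_D, e_a) = n(e_a, e_a) + n(e_{(0,0)}, e_{(0,0)}). In particular n(e_{(0,0)}, e_D) = n(e_D, e_{(0,0)}) = 2·n(e_{(0,0)}, e_{(0,0)}). -/
noncomputable section

namespace RepD8Fusion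

/-- Index of the basis of the fusion ring of `Rep(D₈)`: the four invertible simple
objects labelled by `ℤ/2 × ℤ/2` and the two-dimensional simple object `D`. -/
inductive Bas : Type
  | inv : ZMod 2 × ZMod 2 → Bas
  | D : Bas
  deriving DecidableEq

/-- The fusion ring of `Rep(D₈)` as a free ℤ-module on the five simple objects. -/
abbrev R : Type := Bas →₀ ℤ

/-- The basis element `e_a` for `a ∈ ℤ/2 × ℤ/2`. -/
def e (a : ZMod 2 × ZMod 2) : R := Finsupp.single (Bas.inv a) 1

/-- The basis element `e_D`. -/
def eD : R := Finsupp.single Bas.D 1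

/-- Multiplication on basis elements (the fusion rules of `Rep(D₈)`):
`e_a·e_b = e_{a+b}`, `e_a·e_D = e_D·e_a = e_D`, `e_D·e_D = Σ_a e_a`. -/
def mulB : Bas → Bas → R
  | Bas.inv a, Bas.inv b => e (a + b)
  | Bas.inv _, Bas.D => eD
  | Bas.D, Bas.inv _ => eD
  | Bas.D, Bas.D => ∑ a : ZMod 2 × ZMod 2, e a

/-- The ℤ-bilinear multiplication of the fusion ring, extending the fusion rules. -/
def mul : R →ₗ[ℤ] R →ₗ[ℤ] R :=
  Finsupp.linearCombination ℤ (fun x => Finsupp.linearCombination ℤ (fun y => mulB x y))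

/-- Dimensions of the simple objects: `d(e_a) = 1`, `d(e_D) = 2`. -/
def dB : Bas → ℤ
  | Bas.inv _ => 1
  | Bas.D => 2

/-- The dimension homomorphism `d : R → ℤ` (as a ℤ-linear map; it is the unique ring
homomorphism with `d(e_a) = 1` and `d(e_D) = 2`). -/
def dim : R →ₗ[ℤ] ℤ := Finsupp.linearCombination ℤ dB

end RepD8Fusion

namespace RepD8Fusion

theorem mul_e_e (a b : ZMod 2 × ZMod 2) : mul (e a) (e b) = e (a + b) := by
  simp [mul, e, mulB]

theorem mul_e_eD (a : ZMod 2 × ZMod 2) : mul (e a) eD = eD := by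
  simp [mul, e, eD, mulB]

theorem mul_eD_e (a : ZMod 2 × ZMod 2) : mul eD (e a) = eD := by
  simp [mul, e, eD, mulB]

theorem dim_e (a : ZMod 2 × ZMod 2) : dim (e a) = 1 := by
  simp [dim, e, dB]

theorem dim_eD : dim eD = 2 := by
  simp [dim, eD, dB]

/-- If `n : R × R → ℤ` is ℤ-bilinear and is a 2-cocycle for the
differential `δ` (i.e. `(δn)(r₁,r₂,r₃) = d(r₁)n(r₂,r₃) − n(r₁r₂,r₃) + n(r₁,r₂r₃)
− n(r₁,r₂)d(r₃) = 0` for all `r₁,r₂,r₃`), then for every `a ∈ ℤ/2 × ℤ/2` one has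
`n(e_a, e_D) = n(e_D, e_a) = n(e_a,e_a) + n(e_{(0,0)},e_{(0,0)})`; in particular
`n(e_{(0,0)}, e_D) = n(e_D, e_{(0,0)}) = 2·n(e_{(0,0)},e_{(0,0)})`. -/
theorem two_cocycle_values (n : R →ₗ[ℤ] R →ₗ[ℤ] ℤ)
    (hn : ∀ r₁ r₂ r₃ : R,
      dim r₁ * n r₂ r₃ - n (mul r₁ r₂) r₃ + n r₁ (mul r₂ r₃) - n r₁ r₂ * dim r₃ = 0) :
    (∀ a : ZMod 2 × ZMod 2,
        n (e a) eD = n (e a) (e a) + n (e (0, 0)) (e (0, 0)) ∧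
        n eD (e a) = n (e a) (e a) + n (e (0, 0)) (e (0, 0))) ∧
    n (e (0, 0)) eD = 2 * n (e (0, 0)) (e (0, 0)) ∧
    n eD (e (0, 0)) = 2 * n (e (0, 0)) (e (0, 0)) := by
  have add_self (a : ZMod 2 × ZMod 2) : a + a = (0, 0) := CharTwo.add_self_eq_zero a
  have left (a : ZMod 2 × ZMod 2) :
      n (e a) eD - n (e (0, 0)) eD + n (e a) eD - n (e a) (e a) * 2 = 0 := by
    simpa only [mul_e_e, mul_e_eD, dim_e, dim_eD, add_self, one_mul] using hn (e a) (e a) eD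
  have right (a : ZMod 2 × ZMod 2) :
      2 * n (e a) (e a) - n eD (e a) + n eD (e (0, 0)) - n eD (e a) = 0 := by
    simpa only [mul_e_e, mul_eD_e, dim_e, dim_eD, add_self, mul_one] using hn eD (e a) (e a)
  have left_zero := left (0, 0)
  have right_zero := right (0, 0)
  refine ⟨fun a => ⟨?_, ?_⟩, ?_, ?_⟩
  · linarith [left a]
  · linarith [right a]
  · linarith
  · linarith

end RepD8Fusion
end
end

section
/- Let R be the fusion ring of Rep(D₈) with dimension homomorphism d and differential δ. Then the second cohomology group H² = ker(δ on C²)/im(δ from C¹) of the associated complex is a finite abelian group of cardinality 16. -/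
noncomputable section

namespace RepD8Fusion

/-- The differential `δ₂` on ℤ-bilinear 2-cochains, recorded as an additive group
homomorphism into `ℤ`-valued functions of three variables:
`(δ₂ n)(r₁,r₂,r₃) = d(r₁)n(r₂,r₃) − n(r₁r₂,r₃) + n(r₁,r₂r₃) − n(r₁,r₂)d(r₃)`. -/
def delta2 : (R →ₗ[ℤ] R →ₗ[ℤ] ℤ) →+ (R → R → R → ℤ) where
  toFun n := fun r₁ r₂ r₃ =>
    dim r₁ * n r₂ r₃ - n (mul r₁ r₂) r₃ + n r₁ (mul r₂ r₃) - n r₁ r₂ * dim r₃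
  map_zero' := by
    funext r₁ r₂ r₃; simp
  map_add' n m := by
    funext r₁ r₂ r₃
    simp only [LinearMap.add_apply, Pi.add_apply]
    ring

/-- The differential `δ₁` from ℤ-linear 1-cochains to ℤ-bilinear 2-cochains:
`(δ₁ l)(r,s) = d(r)l(s) − l(rs) + l(r)d(s)`. -/
def delta1 : (R →ₗ[ℤ] ℤ) →+ (R →ₗ[ℤ] R →ₗ[ℤ] ℤ) where
  toFun l := LinearMap.mk₂ ℤ (fun r s => dim r * l s - l (mul r s) + l r * dim s)
    (by intro r₁ r₂ s; simp only [map_add, LinearMap.add_apply]; ring)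
    (by intro c r s
        simp only [map_smul, LinearMap.smul_apply, smul_eq_mul]; ring)
    (by intro r s₁ s₂; simp only [map_add, LinearMap.add_apply]; ring)
    (by intro c r s
        simp only [map_smul, LinearMap.smul_apply, smul_eq_mul]; ring)
  map_zero' := by
    refine LinearMap.ext fun r => LinearMap.ext fun s => ?_
    simp [LinearMap.mk₂_apply]
  map_add' l m := by
    refine LinearMap.ext fun r => LinearMap.ext fun s => ?_
    simp only [LinearMap.mk₂_apply, LinearMap.add_apply]
    ring

/-- The group of ℤ-bilinear 2-cocycles. -/
def Z2 : AddSubgroup (R →ₗ[ℤ] R →ₗ[ℤ] ℤ) := delta2.ker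

/-- The group of ℤ-bilinear 2-coboundaries. -/
def B2 : AddSubgroup (R →ₗ[ℤ] R →ₗ[ℤ] ℤ) := delta1.range

/-- The second cohomology group `H² = ker δ₂ / im δ₁` of the fusion ring of `Rep(D₈)`. -/
abbrev H2 : Type := ↥Z2 ⧸ (B2.addSubgroupOf Z2)

/-- The class in `H²` of a 2-cocycle. -/
def cls (n : R →ₗ[ℤ] R →ₗ[ℤ] ℤ) (hn : n ∈ Z2) : H2 :=
  QuotientAddGroup.mk (⟨n, hn⟩ : ↥Z2)

end RepD8Fusion

namespace RepD8Fusion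


lemma sum_klein {M : Type*} [AddCommMonoid M] (f : ZMod 2 × ZMod 2 → M) :
    ∑ a, f a = f (0, 0) + f (0, 1) + f (1, 0) + f (1, 1) := by
  rw [Fintype.sum_prod_type]
  change ∑ i : Fin 2, ∑ j : Fin 2, f (i, j) = _
  simp only [Fin.sum_univ_two, add_assoc]
  rfl

lemma one_add_one_zmod : (1 + 1 : ZMod 2) = 0 := rfl

lemma klein_cases {P : ZMod 2 × ZMod 2 → Prop} (h00 : P (0, 0)) (h01 : P (0, 1))
    (h10 : P (1, 0)) (h11 : P (1, 1)) (a : ZMod 2 × ZMod 2) : P a := by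
  obtain ⟨i, j⟩ := a
  fin_cases i <;> fin_cases j <;> assumption

/-- The basis element of a simple object. -/
def basisElt (x : Bas) : R := Finsupp.single x 1

lemma dim_basisElt (x : Bas) : dim (basisElt x) = dB x := by
  simp [dim, basisElt]

lemma mul_basisElt (x y : Bas) : mul (basisElt x) (basisElt y) = mulB x y := by
  simp [mul, basisElt]

lemma mulB_inv_inv (a b : ZMod 2 × ZMod 2) :
    mulB (.inv a) (.inv b) = basisElt (.inv (a + b)) := rfl

lemma mulB_inv_D (a : ZMod 2 × ZMod 2) : mulB (.inv a) .D = basisElt .D := rfl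

lemma mulB_D_inv (a : ZMod 2 × ZMod 2) : mulB .D (.inv a) = basisElt .D := rfl

lemma mulB_D_D : mulB .D .D = basisElt (.inv (0, 0)) + basisElt (.inv (0, 1)) +
    basisElt (.inv (1, 0)) + basisElt (.inv (1, 1)) :=
  sum_klein e

lemma linearMap_ext_basisElt {M : Type*} [AddCommGroup M] {f g : R →ₗ[ℤ] M}
    (h : ∀ x, f (basisElt x) = g (basisElt x)) : f = g :=
  Finsupp.lhom_ext' fun x => LinearMap.ext_ring (h x)

lemma bilin_ext_basisElt {n m : R →ₗ[ℤ] R →ₗ[ℤ] ℤ}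
    (h : ∀ x y, n (basisElt x) (basisElt y) = m (basisElt x) (basisElt y)) : n = m :=
  linearMap_ext_basisElt fun x => linearMap_ext_basisElt (h x)

/-- The bilinear form with prescribed values on pairs of simple objects. -/
def bilinOfBasis (c : Bas → Bas → ℤ) : R →ₗ[ℤ] R →ₗ[ℤ] ℤ :=
  Finsupp.linearCombination ℤ fun x => Finsupp.linearCombination ℤ (c x)

lemma bilinOfBasis_apply (c : Bas → Bas → ℤ) (x y : Bas) :
    bilinOfBasis c (basisElt x) (basisElt y) = c x y := by
  simp [bilinOfBasis, basisElt]

lemma delta1_basisElt (l : R →ₗ[ℤ] ℤ) (x y : Bas) :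
    delta1 l (basisElt x) (basisElt y) =
      dB x * l (basisElt y) - l (mulB x y) + l (basisElt x) * dB y := by
  rw [← dim_basisElt, ← dim_basisElt, ← mul_basisElt]
  rfl

/-- The cocycle condition evaluated on three simple objects. -/
def CocycleAt (n : R →ₗ[ℤ] R →ₗ[ℤ] ℤ) (x y z : Bas) : Prop :=
  dB x * n (basisElt y) (basisElt z) - n (mulB x y) (basisElt z)
    + n (basisElt x) (mulB y z) - n (basisElt x) (basisElt y) * dB z = 0

/-- The differential of a bilinear cochain, as a trilinear map. -/
def delta2Lin (n : R →ₗ[ℤ] R →ₗ[ℤ] ℤ) : R →ₗ[ℤ] R →ₗ[ℤ] R →ₗ[ℤ] ℤ :=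
  dim.smulRight n - LinearMap.compr₂ mul n
    + LinearMap.mk₂ ℤ (fun r s => (n r).comp (mul s))
      (by intros; ext; simp) (by intros; ext; simp)
      (by intros; ext; simp) (by intros; ext; simp)
    - LinearMap.mk₂ ℤ (fun r s => n r s • dim)
      (by intros; simp [add_smul]) (by intros; simp [mul_smul])
      (by intros; simp [add_smul]) (by intros; simp [mul_smul])

lemma delta2Lin_apply (n : R →ₗ[ℤ] R →ₗ[ℤ] ℤ) (r s t : R) :
    delta2Lin n r s t = delta2 n r s t := by
  simp [delta2Lin, delta2]

lemma mem_Z2_iff (n : R →ₗ[ℤ] R →ₗ[ℤ] ℤ) : n ∈ Z2 ↔ ∀ x y z, CocycleAt n x y z := by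
  have key (x y z : Bas) : CocycleAt n x y z ↔
      delta2 n (basisElt x) (basisElt y) (basisElt z) = 0 := by
    simp [CocycleAt, delta2, mul_basisElt, dim_basisElt]
  simp only [key]
  refine ⟨fun h x y z => congrFun (congrFun (congrFun h _) _) _, fun h => ?_⟩
  have h0 : delta2Lin n = 0 :=
    linearMap_ext_basisElt fun x => bilin_ext_basisElt fun y z => by
      rw [delta2Lin_apply, h]; rfl
  funext r s t
  rw [← delta2Lin_apply, h0]; rfl

lemma delta1_mem_Z2 (l : R →ₗ[ℤ] ℤ) : delta1 l ∈ Z2 := by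
  rw [mem_Z2_iff]
  rintro (a | _) (b | _) (c | _)
  case D.D.inv =>
    induction c using klein_cases <;>
    simp [CocycleAt, mulB_D_inv, mulB_inv_inv, mulB_D_D, delta1_basisElt, dB,
      one_add_one_zmod] <;>
    ring
  case inv.D.D =>
    induction a using klein_cases <;>
    simp [CocycleAt, mulB_inv_D, mulB_inv_inv, mulB_D_D, delta1_basisElt, dB,
      one_add_one_zmod] <;>
    ring
  all_goals
    simp [CocycleAt, mulB_inv_inv, mulB_inv_D, mulB_D_inv, mulB_D_D, delta1_basisElt, dB,
      add_assoc]
  all_goals ring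

/-- A cocycle that vanishes on enough pairs of simple objects is zero. -/
lemma eq_zero_of_mem_Z2 {n : R →ₗ[ℤ] R →ₗ[ℤ] ℤ} (hn : n ∈ Z2)
    (h0 : n (basisElt (.inv (0, 0))) (basisElt (.inv (0, 0))) = 0)
    (h1 : n (basisElt (.inv (1, 0))) (basisElt (.inv (1, 0))) = 0)
    (h2 : n (basisElt (.inv (0, 1))) (basisElt (.inv (0, 1))) = 0)
    (h3 : n (basisElt (.inv (1, 0))) (basisElt (.inv (0, 1))) = 0)
    (hD : n (basisElt .D) (basisElt .D) = 0) : n = 0 := by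
  rw [mem_Z2_iff] at hn
  have hinv (a b c : ZMod 2 × ZMod 2) := hn (.inv a) (.inv b) (.inv c)
  have hinvD (a : ZMod 2 × ZMod 2) := hn (.inv a) (.inv a) .D
  have hDinv (a : ZMod 2 × ZMod 2) := hn .D (.inv a) (.inv a)
  simp only [CocycleAt, mulB_inv_inv, mulB_inv_D, mulB_D_inv, dB, one_mul, mul_one]
    at hinv hinvD hDinv
  have hself (a : ZMod 2 × ZMod 2) : a + a = (0, 0) := by revert a; decide
  have hl (a) : n (basisElt (.inv (0, 0))) (basisElt (.inv a)) = 0 := by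
    have := hinv (0, 0) (0, 0) a
    rw [← Prod.zero_eq_mk] at *
    simp only [zero_add] at this
    linarith
  have hr (a) : n (basisElt (.inv a)) (basisElt (.inv (0, 0))) = 0 := by
    have := hinv a (0, 0) (0, 0)
    rw [← Prod.zero_eq_mk] at *
    simp only [add_zero] at this
    linarith
  have aab := hinv (1, 0) (1, 0) (0, 1)
  have abb := hinv (1, 0) (0, 1) (0, 1)
  have bba := hinv (0, 1) (0, 1) (1, 0)
  have baa := hinv (0, 1) (1, 0) (1, 0)
  have aba := hinv (1, 0) (0, 1) (1, 0)
  have abs := hinv (1, 0) (0, 1) (1, 1)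
  simp only [Prod.mk_add_mk, add_zero, zero_add, one_add_one_zmod] at aab abb bba baa aba abs
  have hss (a b : ZMod 2 × ZMod 2) : n (basisElt (.inv a)) (basisElt (.inv b)) = 0 := by
    induction a using klein_cases <;> induction b using klein_cases <;>
    linarith [hl (0, 1), hl (1, 0), hl (1, 1), hr (0, 1), hr (1, 0), hr (1, 1)]
  refine bilin_ext_basisElt ?_
  have hl0 := hinvD (0, 0)
  have hr0 := hDinv (0, 0)
  simp only [hself, hss] at hl0 hr0
  rintro (a | _) (b | _)
  · exact hss a b
  · have := hinvD a
    simp only [hself, hss] at this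
    simp only [LinearMap.zero_apply]
    linarith
  · have := hDinv b
    simp only [hself, hss] at this
    simp only [LinearMap.zero_apply]
    linarith
  · exact hD

/-- The invariant of a bilinear cochain whose restriction to cocycles classifies `H²`. -/
def classify : (R →ₗ[ℤ] R →ₗ[ℤ] ℤ) →+ ZMod 2 × ZMod 2 × ZMod 4 where
  toFun n :=
    let c x y := n (basisElt x) (basisElt y)
    (((c (.inv (1, 0)) (.inv (1, 0)) + c (.inv (0, 0)) (.inv (0, 0)) : ℤ) : ZMod 2),
      ((c (.inv (0, 1)) (.inv (0, 1)) + c (.inv (0, 0)) (.inv (0, 0)) : ℤ) : ZMod 2),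
      ((c .D .D + 3 * c (.inv (0, 0)) (.inv (0, 0)) + c (.inv (1, 0)) (.inv (1, 0))
        + c (.inv (0, 1)) (.inv (0, 1)) - c (.inv (1, 0)) (.inv (0, 1)) : ℤ) : ZMod 4))
  map_zero' := by simp
  map_add' n m := by
    ext <;> simp <;> ring

lemma classify_delta1 (l : R →ₗ[ℤ] ℤ) : classify (delta1 l) = 0 := by
  have h2 : (2 : ZMod 2) = 0 := rfl
  have h4 : (4 : ZMod 4) = 0 := rfl
  ext
  · simp [classify, delta1_basisElt, mulB_inv_inv, dB, one_add_one_zmod]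
    linear_combination (l (basisElt (.inv (1, 0))) : ZMod 2) * h2
  · simp [classify, delta1_basisElt, mulB_inv_inv, dB, one_add_one_zmod]
    linear_combination (l (basisElt (.inv (0, 1))) : ZMod 2) * h2
  · simp [classify, delta1_basisElt, mulB_inv_inv, mulB_D_D, dB, one_add_one_zmod]
    linear_combination (l (basisElt .D) : ZMod 4) * h4

lemma mem_B2_of_classify_eq_zero {n : R →ₗ[ℤ] R →ₗ[ℤ] ℤ} (hn : n ∈ Z2)
    (h : classify n = 0) : n ∈ B2 := by
  simp only [classify, AddMonoidHom.coe_mk, ZeroHom.coe_mk, Prod.mk_eq_zero,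
    ZMod.intCast_zmod_eq_zero_iff_dvd] at h
  obtain ⟨⟨p, hp⟩, ⟨q, hq⟩, ⟨d, hd⟩⟩ := h
  push_cast at hp hq hd
  set l : R →ₗ[ℤ] ℤ := Finsupp.linearCombination ℤ fun x => match x with
    | .inv (0, 0) => n (basisElt (.inv (0, 0))) (basisElt (.inv (0, 0)))
    | .inv (1, 0) => p
    | .inv (0, 1) => q
    | .inv (1, 1) => p + q - n (basisElt (.inv (1, 0))) (basisElt (.inv (0, 1)))
    | .D => d
  have l0 : l (basisElt (.inv (0, 0))) =
      n (basisElt (.inv (0, 0))) (basisElt (.inv (0, 0))) := by simp [l, basisElt]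
  have la : l (basisElt (.inv (1, 0))) = p := by simp [l, basisElt]
  have lb : l (basisElt (.inv (0, 1))) = q := by simp [l, basisElt]
  have lab : l (basisElt (.inv (1, 1))) =
      p + q - n (basisElt (.inv (1, 0))) (basisElt (.inv (0, 1))) := by simp [l, basisElt]
  have lD : l (basisElt .D) = d := by simp [l, basisElt]
  clear_value l
  refine ⟨l, (sub_eq_zero.mp (eq_zero_of_mem_Z2 (Z2.sub_mem hn (delta1_mem_Z2 l))
    ?_ ?_ ?_ ?_ ?_)).symm⟩ <;>
  simp [delta1_basisElt, mulB_inv_inv, mulB_D_D, dB, one_add_one_zmod, l0, la, lb, lab, lD] <;>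
  linarith

/-- Coefficients of a cocycle realising a prescribed class. -/
def classCoeff (x y z : ℤ) : Bas → Bas → ℤ
  | .inv a, .inv b => x * (a.1.val * b.1.val) + y * (a.2.val * b.2.val)
  | .inv a, .D => x * a.1.val + y * a.2.val
  | .D, .inv a => x * a.1.val + y * a.2.val
  | .D, .D => z - x - y

lemma val_add_zmod_two (i j : ZMod 2) :
    ((i + j).val : ℤ) = i.val + j.val - 2 * (i.val * j.val) := by
  revert i j; decide

lemma bilinOfBasis_classCoeff_mem_Z2 (x y z : ℤ) : bilinOfBasis (classCoeff x y z) ∈ Z2 := by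
  rw [mem_Z2_iff]
  rintro (a | _) (b | _) (c | _) <;>
  simp [CocycleAt, mulB_inv_inv, mulB_inv_D, mulB_D_inv, mulB_D_D, bilinOfBasis_apply, classCoeff,
    dB, val_add_zmod_two, ZMod.val_one, -ZMod.natCast_val] <;> ring

lemma classify_classCoeff (x y z : ℤ) : classify (bilinOfBasis (classCoeff x y z)) =
    ((x : ZMod 2), (y : ZMod 2), (z : ZMod 4)) := by
  simp [classify, bilinOfBasis_apply, classCoeff, ZMod.val_one]
  ring

/-- The second cohomology group `H² = ker δ₂ / im δ₁` of the complex of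
ℤ-multilinear cochains on the fusion ring of `Rep(D₈)` (with the dimension-twisted
differential) is a finite (abelian) group of cardinality 16. -/
theorem card_H2 : Nat.card H2 = 16 := by
  have hsurj : Function.Surjective (classify.comp Z2.subtype) := by
    rintro ⟨x, y, z⟩
    obtain ⟨x, rfl⟩ := ZMod.intCast_surjective x
    obtain ⟨y, rfl⟩ := ZMod.intCast_surjective y
    obtain ⟨z, rfl⟩ := ZMod.intCast_surjective z
    exact ⟨⟨_, bilinOfBasis_classCoeff_mem_Z2 x y z⟩, classify_classCoeff x y z⟩
  have hker : B2.addSubgroupOf Z2 = (classify.comp Z2.subtype).ker := by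
    ext ⟨n, hn⟩
    rw [AddSubgroup.mem_addSubgroupOf, AddMonoidHom.mem_ker]
    refine ⟨?_, mem_B2_of_classify_eq_zero hn⟩
    rintro ⟨l, hl⟩
    exact (congrArg classify hl.symm).trans (classify_delta1 l)
  rw [Nat.card_congr ((QuotientAddGroup.quotientAddEquivOfEq hker).trans
    (QuotientAddGroup.quotientKerEquivOfSurjective _ hsurj)).toEquiv]
  simp

end RepD8Fusion
end
end

section
/- Let A be the 8-dimensional ℂ-vector space with basis {u_a : a ∈ K} ∪ {v_{ij} : i,j ∈ {1,2}}, equipped with the ℂ-bilinear multiplication determined by: u_a·u_b = u_{a+b}; u_a·v_{ij} = v_{ij}·u_a = Σ_{k,l} (P_a)_{ik}(P_a)_{lj} v_{kl}; and v_{ij}·v_{kl} = (1/2)X_{ik}X_{jl}·u_{(0,0)} − (1/2)Y_{ik}Y_{jl}·u_{(0,1)} + (1/2)δ_{ik}δ_{jl}·u_{(1,0)} + (1/2)Z_{ik}Z_{jl}·u_{(1,1)}. Then this multiplication is associative with two-sided unit u_{(0,0)}, A is commutative, and A is isomorphic as a ℂ-algebra to ℂ⁸ (the product of eight copies of ℂ);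 in particular A has exactly eight unital ℂ-algebra homomorphisms to ℂ. (A is the self-interface algebra of the Rep(D₈) SPT phase ν₁.) -/
noncomputable section

namespace RepD8InterfaceNu1

/-- `K = ℤ/2 × ℤ/2`. -/
abbrev K : Type := ZMod 2 × ZMod 2

/-- Basis of the interface algebra: `u_a` for `a ∈ K` and `v_{ij}` for `i,j ∈ {1,2}`. -/
abbrev Bas : Type := K ⊕ (Fin 2 × Fin 2)

/-- The underlying 8-dimensional ℂ-vector space. -/
abbrev A : Type := Bas →₀ ℂ

/-- Basis vector `u_a`. -/
def u (a : K) : A := Finsupp.single (Sum.inl a) 1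

/-- Basis vector `v_{ij}`. -/
def v (i j : Fin 2) : A := Finsupp.single (Sum.inr (i, j)) 1

/-- Pauli matrix `X`. -/
def X : Matrix (Fin 2) (Fin 2) ℂ := !![0, 1; 1, 0]

/-- Pauli matrix `Y`. -/
def Y : Matrix (Fin 2) (Fin 2) ℂ := !![0, -Complex.I; Complex.I, 0]

/-- Pauli matrix `Z`. -/
def Z : Matrix (Fin 2) (Fin 2) ℂ := !![1, 0; 0, -1]

/-- `P_{(0,0)} = I₂`, `P_{(0,1)} = Z`, `P_{(1,0)} = X`, `P_{(1,1)} = Y`. -/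
def P : K → Matrix (Fin 2) (Fin 2) ℂ := fun a =>
  if a = (0, 0) then 1 else if a = (0, 1) then Z else if a = (1, 0) then X else Y

/-- Structure constants of the algebra `A` (the self-interface algebra of the
`Rep(D₈)` SPT phase `ν₁`):
`u_a·u_b = u_{a+b}`;
`u_a·v_{ij} = v_{ij}·u_a = Σ_{k,l} (P_a)_{ik}(P_a)_{lj} v_{kl}`;
`v_{ij}·v_{kl} = ½X_{ik}X_{jl}·u_{(0,0)} − ½Y_{ik}Y_{jl}·u_{(0,1)}
  + ½δ_{ik}δ_{jl}·u_{(1,0)} + ½Z_{ik}Z_{jl}·u_{(1,1)}`. -/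
def mulB : Bas → Bas → A
  | Sum.inl a, Sum.inl b => u (a + b)
  | Sum.inl a, Sum.inr (i, j) => ∑ k : Fin 2, ∑ l : Fin 2, (P a i k * P a l j) • v k l
  | Sum.inr (i, j), Sum.inl a => ∑ k : Fin 2, ∑ l : Fin 2, (P a i k * P a l j) • v k l
  | Sum.inr (i, j), Sum.inr (k, l) =>
      ((1 : ℂ) / 2 * (X i k * X j l)) • u (0, 0)
        - ((1 : ℂ) / 2 * (Y i k * Y j l)) • u (0, 1)
        + ((1 : ℂ) / 2 * ((if i = k then (1 : ℂ) else 0) * (if j = l then (1 : ℂ) else 0))) • u (1, 0)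
        + ((1 : ℂ) / 2 * (Z i k * Z j l)) • u (1, 1)

/-- The ℂ-bilinear multiplication of `A` determined by the structure constants. -/
def mulA (x y : A) : A :=
  x.sum fun b c => y.sum fun b' c' => (c * c') • mulB b b'

/-- The bicharacter of `K` recording whether `P a` and `P b` commute or anticommute. -/
def commSign (b a : K) : ℂ := if b.1 * a.2 + b.2 * a.1 = 0 then 1 else -1

/-- The normalization making `P b` the restriction of a character of `A` to the `v i j`. -/
def pauliPhase (b : K) : ℂ := if b = (0, 1) then Complex.I else 1

/-- The values on the basis of the character of `A` indexed by `b : K` and a sign. -/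
def charVal (c : K × ℤˣ) : Bas → ℂ
  | Sum.inl a => commSign c.1 a
  | Sum.inr (i, j) => ((c.2 : ℤ) : ℂ) * (pauliPhase c.1 * P c.1 i j)

/-- The character of `A` with values `charVal c` on the basis. -/
def char (c : K × ℤˣ) : A →ₗ[ℂ] ℂ := Finsupp.linearCombination ℂ (charVal c)

lemma char_single (c : K × ℤˣ) (e : Bas) (r : ℂ) :
    char c (Finsupp.single e r) = r * charVal c e := by
  simp [char]

lemma char_u (c : K × ℤˣ) (a : K) : char c (u a) = commSign c.1 a := by
  simp [u, char_single, charVal]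

lemma char_v (c : K × ℤˣ) (i j : Fin 2) :
    char c (v i j) = ((c.2 : ℤ) : ℂ) * (pauliPhase c.1 * P c.1 i j) := by
  simp [v, char_single, charVal]

lemma forall_K {p : K → Prop} :
    (∀ a, p a) ↔ p (0, 0) ∧ p (0, 1) ∧ p (1, 0) ∧ p (1, 1) := by
  constructor
  · intro h
    exact ⟨h _, h _, h _, h _⟩
  · rintro ⟨h₀, h₁, h₂, h₃⟩ ⟨a, b⟩
    fin_cases a <;> fin_cases b <;> assumption

lemma units_sq_cast (s : ℤˣ) : ((s : ℤ) : ℂ) * ((s : ℤ) : ℂ) = 1 := by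
  rcases Int.units_eq_one_or s with rfl | rfl <;> simp

lemma commSign_add (b a a' : K) : commSign b (a + a') = commSign b a * commSign b a' := by
  have h11 : (1 : ZMod 2) + 1 = 0 := rfl
  revert b a a'
  simp only [forall_K]
  simp [commSign, h11]

lemma P_conj (a b : K) : P a * P b * P a = commSign b a • P b := by
  have h11 : (1 : ZMod 2) + 1 = 0 := rfl
  revert a b
  simp only [forall_K]
  simp [commSign, P, X, Y, Z, h11, Matrix.one_fin_two]

lemma P_mul_P (b : K) (i j k l : Fin 2) :
    (pauliPhase b * P b i j) * (pauliPhase b * P b k l) =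
      (1 : ℂ) / 2 * (X i k * X j l) * commSign b (0, 0)
        - (1 : ℂ) / 2 * (Y i k * Y j l) * commSign b (0, 1)
        + (1 : ℂ) / 2 * ((if i = k then (1 : ℂ) else 0) * (if j = l then (1 : ℂ) else 0)) *
          commSign b (1, 0)
        + (1 : ℂ) / 2 * (Z i k * Z j l) * commSign b (1, 1) := by
  have h11 : (1 : ZMod 2) + 1 = 0 := rfl
  revert b
  rw [forall_K]
  refine ⟨?_, ?_, ?_, ?_⟩ <;> fin_cases i <;> fin_cases j <;> fin_cases k <;> fin_cases l <;>
    simp [commSign, pauliPhase, P, X, Y, Z, h11] <;> norm_num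

lemma char_mulB (c : K × ℤˣ) (e e' : Bas) :
    char c (mulB e e') = charVal c e * charVal c e' := by
  have key (a : K) (i j : Fin 2) :
      char c (∑ k : Fin 2, ∑ l : Fin 2, (P a i k * P a l j) • v k l) =
        commSign c.1 a * (((c.2 : ℤ) : ℂ) * (pauliPhase c.1 * P c.1 i j)) := by
    have h := congrFun (congrFun (P_conj a c.1) i) j
    simp only [Matrix.mul_apply, Fin.sum_univ_two, Matrix.smul_apply, smul_eq_mul] at h
    simp only [map_add, map_smul, char_v, Fin.sum_univ_two, smul_eq_mul]
    linear_combination ((c.2 : ℤ) : ℂ) * pauliPhase c.1 * h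
  rcases e with a | ⟨i, j⟩ <;> rcases e' with a' | ⟨k, l⟩
  · simp only [mulB, char_u, charVal, commSign_add]
  · simp only [mulB, key, charVal]
  · simp only [mulB, key, charVal, mul_comm]
  · simp only [mulB, map_add, map_sub, map_smul, char_u, charVal, smul_eq_mul]
    linear_combination -P_mul_P c.1 i j k l - (pauliPhase c.1 * P c.1 i j) *
      (pauliPhase c.1 * P c.1 k l) * units_sq_cast c.2

lemma char_mulA (c : K × ℤˣ) (x y : A) : char c (mulA x y) = char c x * char c y := by
  simp only [mulA, Finsupp.sum, map_sum, map_smul, char_mulB, smul_eq_mul]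
  simp only [char, Finsupp.linearCombination_apply, Finsupp.sum, smul_eq_mul, Finset.sum_mul_sum]
  exact Finset.sum_congr rfl fun _ _ => Finset.sum_congr rfl fun _ _ => by ring

lemma char_one (c : K × ℤˣ) : char c (u (0, 0)) = 1 := by
  simp [char_u, commSign]

lemma char_apply (c : K × ℤˣ) (x : A) :
    char c x =
      x (Sum.inl (0, 0)) * commSign c.1 (0, 0) + x (Sum.inl (0, 1)) * commSign c.1 (0, 1)
      + x (Sum.inl (1, 0)) * commSign c.1 (1, 0) + x (Sum.inl (1, 1)) * commSign c.1 (1, 1)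
      + ((c.2 : ℤ) : ℂ) * pauliPhase c.1 *
        (x (Sum.inr (0, 0)) * P c.1 0 0 + x (Sum.inr (0, 1)) * P c.1 0 1
        + x (Sum.inr (1, 0)) * P c.1 1 0 + x (Sum.inr (1, 1)) * P c.1 1 1) := by
  have hK (g : K → ℂ) : ∑ a, g a = g (0, 0) + g (0, 1) + g (1, 0) + g (1, 1) := by
    rw [Fintype.sum_prod_type]
    change ∑ a : Fin 2, ∑ b : Fin 2, g (a, b) = _
    simp only [Fin.sum_univ_two]
    exact (add_assoc _ _ _).symm
  rw [char, Finsupp.linearCombination_apply, Finsupp.sum_fintype _ _ (by simp),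
    Fintype.sum_sum_type, hK, Fintype.sum_prod_type]
  simp only [Fin.sum_univ_two, charVal, smul_eq_mul]
  ring

lemma eq_zero_of_char_eq_zero (x : A) (h : ∀ c, char c x = 0) : x = 0 := by
  have h11 : (1 : ZMod 2) + 1 = 0 := rfl
  have hs (b : K) :
      x (Sum.inl (0, 0)) * commSign b (0, 0) + x (Sum.inl (0, 1)) * commSign b (0, 1)
        + x (Sum.inl (1, 0)) * commSign b (1, 0) + x (Sum.inl (1, 1)) * commSign b (1, 1) = 0 ∧
      x (Sum.inr (0, 0)) * P b 0 0 + x (Sum.inr (0, 1)) * P b 0 1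
        + x (Sum.inr (1, 0)) * P b 1 0 + x (Sum.inr (1, 1)) * P b 1 1 = 0 := by
    have h₁ := h (b, 1)
    have h₂ := h (b, -1)
    have hp : pauliPhase b ≠ 0 := by unfold pauliPhase; split_ifs <;> simp
    rw [char_apply] at h₁ h₂
    push_cast at h₁ h₂
    constructor
    · linear_combination h₁ / 2 + h₂ / 2
    · apply mul_left_cancel₀ hp
      linear_combination h₁ / 2 - h₂ / 2
  obtain ⟨⟨a₀, b₀⟩, ⟨a₁, b₁⟩, ⟨a₂, b₂⟩, ⟨a₃, b₃⟩⟩ := forall_K.1 hs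
  simp [commSign, P, X, Y, Z, h11] at a₀ a₁ a₂ a₃ b₀ b₁ b₂ b₃
  ext e
  rcases e with a | ⟨i, j⟩
  · revert a
    rw [forall_K]
    simp only [Finsupp.coe_zero, Pi.zero_apply]
    refine ⟨?_, ?_, ?_, ?_⟩
    · linear_combination (a₀ + a₁ + a₂ + a₃) / 4
    · linear_combination (a₀ + a₁ - a₂ - a₃) / 4
    · linear_combination (a₀ - a₁ + a₂ - a₃) / 4
    · linear_combination (a₀ - a₁ - a₂ + a₃) / 4
  · fin_cases i <;> fin_cases j <;> simp
    · linear_combination (b₀ + b₁) / 2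
    · linear_combination (b₂ + Complex.I * b₃) / 2 +
        (x (Sum.inr (0, 1)) - x (Sum.inr (1, 0))) / 2 * Complex.I_mul_I
    · linear_combination (b₂ - Complex.I * b₃) / 2 -
        (x (Sum.inr (0, 1)) - x (Sum.inr (1, 0))) / 2 * Complex.I_mul_I
    · linear_combination (b₀ - b₁) / 2

/-- An enumeration of the index set of the characters. -/
def charIndex : Fin 8 ≃ K × ℤˣ := (Fintype.equivFinOfCardEq (by decide)).symm

/-- The isomorphism of `A` with `ℂ⁸` given by its eight characters. -/
def charEquiv : A ≃ₗ[ℂ] (Fin 8 → ℂ) :=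
  LinearEquiv.ofInjectiveOfFinrankEq (LinearMap.pi fun n => char (charIndex n))
    (by
      rw [injective_iff_map_eq_zero]
      intro x hx
      refine eq_zero_of_char_eq_zero x fun c => ?_
      simpa using congrFun hx (charIndex.symm c))
    (by simp)

lemma charEquiv_apply (x : A) (n : Fin 8) : charEquiv x n = char (charIndex n) x := rfl

lemma charEquiv_mulA (x y : A) : charEquiv (mulA x y) = charEquiv x * charEquiv y := by
  ext n
  simp [charEquiv_apply, char_mulA]

lemma charEquiv_one : charEquiv (u (0, 0)) = 1 := by
  ext n
  simp [charEquiv_apply, char_one]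

/-- A unital multiplicative linear functional on a finite power of a field is an evaluation. -/
lemma exists_eq_eval {𝕜 ι : Type*} [Field 𝕜] [Fintype ι] [DecidableEq ι]
    (ψ : (ι → 𝕜) →ₗ[𝕜] 𝕜) (hmul : ∀ x y, ψ (x * y) = ψ x * ψ y) (hone : ψ 1 = 1) :
    ∃ i, ∀ x, ψ x = x i := by
  have hex : ∃ i, ψ (Pi.single i 1) ≠ 0 := by
    by_contra! h
    have h₁ : ψ (∑ i, Pi.single i (1 : 𝕜)) = 0 := by simp [h]
    rw [show ∑ i, Pi.single i (1 : 𝕜) = (1 : ι → 𝕜) from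
      Finset.univ_sum_single (1 : ι → 𝕜), hone] at h₁
    exact one_ne_zero h₁
  obtain ⟨i, hi⟩ := hex
  refine ⟨i, fun x => mul_right_cancel₀ hi ?_⟩
  have h : x * Pi.single i 1 = x i • Pi.single i (1 : 𝕜) := by
    ext j
    rcases eq_or_ne j i with rfl | hj <;> simp [*]
  rw [← hmul, h, map_smul, smul_eq_mul]

lemma char_bijective :
    Function.Bijective (fun n : Fin 8 =>
      (⟨char (charIndex n), char_mulA _, char_one _⟩ : {φ : A →ₗ[ℂ] ℂ //
        (∀ x y : A, φ (mulA x y) = φ x * φ y) ∧ φ (u (0, 0)) = 1})) := by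
  constructor
  · intro m n h
    by_contra hmn
    have h' := LinearMap.congr_fun (congrArg Subtype.val h) (charEquiv.symm (Pi.single m 1))
    simp [← charEquiv_apply, Ne.symm hmn] at h'
  · rintro ⟨φ, hmul, hone⟩
    obtain ⟨n, hn⟩ := exists_eq_eval (φ ∘ₗ charEquiv.symm.toLinearMap)
      (fun x y => by
        have hxy : charEquiv.symm (x * y) = mulA (charEquiv.symm x) (charEquiv.symm y) := by
          rw [LinearEquiv.symm_apply_eq, charEquiv_mulA]
          simp
        simp [hxy, hmul])
      (by simp [← charEquiv_one, hone])
    refine ⟨n, Subtype.ext (LinearMap.ext fun x => ?_)⟩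
    simpa [charEquiv_apply] using (hn (charEquiv x)).symm

/-- The multiplication of `A` is associative with two-sided unit
`u_{(0,0)}`, `A` is commutative, `A` is isomorphic as a ℂ-algebra to `ℂ⁸` (the product
of eight copies of `ℂ`), and `A` has exactly eight unital ℂ-algebra homomorphisms
to `ℂ`. -/
theorem nu1_self_interface_algebra :
    (∀ x y z : A, mulA (mulA x y) z = mulA x (mulA y z)) ∧
    (∀ x : A, mulA (u (0, 0)) x = x ∧ mulA x (u (0, 0)) = x) ∧
    (∀ x y : A, mulA x y = mulA y x) ∧
    (∃ f : A ≃ₗ[ℂ] (Fin 8 → ℂ),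
        (∀ x y : A, f (mulA x y) = f x * f y) ∧ f (u (0, 0)) = 1) ∧
    Nat.card {φ : A →ₗ[ℂ] ℂ //
        (∀ x y : A, φ (mulA x y) = φ x * φ y) ∧ φ (u (0, 0)) = 1} = 8 := by
  refine ⟨fun x y z => charEquiv.injective ?_,
    fun x => ⟨charEquiv.injective ?_, charEquiv.injective ?_⟩,
    fun x y => charEquiv.injective ?_,
    ⟨charEquiv, charEquiv_mulA, charEquiv_one⟩, ?_⟩
  · simp only [charEquiv_mulA, mul_assoc]
  · rw [charEquiv_mulA, charEquiv_one, one_mul]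
  · rw [charEquiv_mulA, charEquiv_one, mul_one]
  · rw [charEquiv_mulA, charEquiv_mulA, mul_comm]
  · rw [← Nat.card_eq_of_bijective _ char_bijective, Nat.card_fin]

end RepD8InterfaceNu1
end
end

section
/- Let B be the 8-dimensional ℂ-vector space with basis {u_a : a ∈ K} ∪ {v_{ij} : i,j ∈ {1,2}}, equipped with the ℂ-bilinear multiplication determined by: u_a·u_b = u_{a+b}; u_a·v_{ij} = Σ_{k,l} (P_a)_{ik}(P_a)_{lj} v_{kl}; v_{ij}·u_a = ε(a)·Σ_{k,l} (P_a)_{ik}(P_a)_{lj} v_{kl}, where ε(0,0) = ε(1,1) = 1 and ε(0,1) = ε(1,0) = −1; and v_{ij}·v_{kl} = (1/2)X_{ik}Z_{jl}·u_{(0,0)} + (i/2)Y_{ik}δ_{jl}·u_{(0,1)} − (i/2)δ_{ik}Y_{jl}·u_{(1,0)} − (1/2)Z_{ik}X_{jl}·u_{(1,1)}. Then this multiplication is associative with two-sided unit u_{(0,0)}, and B is isomorphic as a ℂ-algebra to M₂(ℂ) × M₂(ℂ); consequently B admits no unital ℂ-algebra homomorphism to ℂ. (B is the interface algebra between the distinct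 Rep(D₈) SPT phases ν₁ and ν₂.) -/
noncomputable section

namespace RepD8InterfaceNu1Nu2

/-- `K = ℤ/2 × ℤ/2`. -/
abbrev K : Type := ZMod 2 × ZMod 2

/-- Basis of the interface algebra: `u_a` for `a ∈ K` and `v_{ij}` for `i,j ∈ {1,2}`. -/
abbrev Bas : Type := K ⊕ (Fin 2 × Fin 2)

/-- The underlying 8-dimensional ℂ-vector space. -/
abbrev B : Type := Bas →₀ ℂ

/-- Basis vector `u_a`. -/
def u (a : K) : B := Finsupp.single (Sum.inl a) 1

/-- Basis vector `v_{ij}`. -/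
def v (i j : Fin 2) : B := Finsupp.single (Sum.inr (i, j)) 1

/-- Pauli matrix `X`. -/
def X : Matrix (Fin 2) (Fin 2) ℂ := !![0, 1; 1, 0]

/-- Pauli matrix `Y`. -/
def Y : Matrix (Fin 2) (Fin 2) ℂ := !![0, -Complex.I; Complex.I, 0]

/-- Pauli matrix `Z`. -/
def Z : Matrix (Fin 2) (Fin 2) ℂ := !![1, 0; 0, -1]

/-- `P_{(0,0)} = I₂`, `P_{(0,1)} = Z`, `P_{(1,0)} = X`, `P_{(1,1)} = Y`. -/
def P : K → Matrix (Fin 2) (Fin 2) ℂ := fun a =>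
  if a = (0, 0) then 1 else if a = (0, 1) then Z else if a = (1, 0) then X else Y

/-- The sign `ε` with `ε(0,0) = ε(1,1) = 1` and `ε(0,1) = ε(1,0) = −1`. -/
def eps : K → ℂ := fun a => if a = (0, 0) ∨ a = (1, 1) then 1 else -1

/-- Structure constants of the algebra `B` (the interface algebra between the distinct
`Rep(D₈)` SPT phases `ν₁` and `ν₂`):
`u_a·u_b = u_{a+b}`;
`u_a·v_{ij} = Σ_{k,l} (P_a)_{ik}(P_a)_{lj} v_{kl}`;
`v_{ij}·u_a = ε(a)·Σ_{k,l} (P_a)_{ik}(P_a)_{lj} v_{kl}`;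
`v_{ij}·v_{kl} = ½X_{ik}Z_{jl}·u_{(0,0)} + (i/2)Y_{ik}δ_{jl}·u_{(0,1)}
  − (i/2)δ_{ik}Y_{jl}·u_{(1,0)} − ½Z_{ik}X_{jl}·u_{(1,1)}`. -/
def mulB : Bas → Bas → B
  | Sum.inl a, Sum.inl b => u (a + b)
  | Sum.inl a, Sum.inr (i, j) => ∑ k : Fin 2, ∑ l : Fin 2, (P a i k * P a l j) • v k l
  | Sum.inr (i, j), Sum.inl a =>
      ∑ k : Fin 2, ∑ l : Fin 2, (eps a * (P a i k * P a l j)) • v k l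
  | Sum.inr (i, j), Sum.inr (k, l) =>
      ((1 : ℂ) / 2 * (X i k * Z j l)) • u (0, 0)
        + (Complex.I / 2 * (Y i k * (if j = l then (1 : ℂ) else 0))) • u (0, 1)
        - (Complex.I / 2 * ((if i = k then (1 : ℂ) else 0) * Y j l)) • u (1, 0)
        - ((1 : ℂ) / 2 * (Z i k * X j l)) • u (1, 1)

/-- The ℂ-bilinear multiplication of `B` determined by the structure constants. -/
def mulA (x y : B) : B :=
  x.sum fun b c => y.sum fun b' c' => (c * c') • mulB b b'

/-- The value on basis vectors of the two-dimensional representation of `B` in which the central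
element `u_{(1,1)}` acts as the scalar `s`, where `s ^ 2 = 1`. -/
def repBasis (s : ℂ) : Bas → Matrix (Fin 2) (Fin 2) ℂ
  | Sum.inl a =>
      if a = (0, 0) then 1 else if a = (0, 1) then Z else if a = (1, 0) then s • Z else s • 1
  | Sum.inr (i, j) =>
      !![!![0, 1; 0, 0], !![0, 0; -s, 0]; !![0, 0; 1, 0], !![0, s; 0, 0]] i j

/-- The two-dimensional representation of `B` in which `u_{(1,1)}` acts as the scalar `s`. -/
def rep (s : ℂ) : B →ₗ[ℂ] Matrix (Fin 2) (Fin 2) ℂ := Finsupp.linearCombination ℂ (repBasis s)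

lemma sum_K {M : Type*} [AddCommMonoid M] (f : K → M) :
    ∑ a, f a = f (0, 0) + f (0, 1) + (f (1, 0) + f (1, 1)) := by
  have h (g : ZMod 2 → M) : ∑ a, g a = g 0 + g 1 := Fin.sum_univ_two g
  rw [Fintype.sum_prod_type, h, h, h]

lemma forall_K {p : K → Prop} (h₀ : p (0, 0)) (h₁ : p (0, 1)) (h₂ : p (1, 0)) (h₃ : p (1, 1)) :
    ∀ a, p a := by
  rintro ⟨a, b⟩
  fin_cases a <;> fin_cases b <;> assumption

lemma rep_u (s : ℂ) (a : K) : rep s (u a) = repBasis s (Sum.inl a) := by simp [rep, u]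

lemma rep_v (s : ℂ) (i j : Fin 2) : rep s (v i j) = repBasis s (Sum.inr (i, j)) := by
  simp [rep, v]

lemma mulA_eq_sum (x y : B) : mulA x y = ∑ b, ∑ b', (x b * y b') • mulB b b' := by
  rw [mulA, Finsupp.sum_fintype _ _ (by simp)]
  refine Finset.sum_congr rfl fun b _ => ?_
  rw [Finsupp.sum_fintype _ _ (by simp)]

lemma rep_apply (s : ℂ) (x : B) : rep s x = ∑ b, x b • repBasis s b := by
  rw [rep, Finsupp.linearCombination_apply, Finsupp.sum_fintype _ _ (by simp)]

lemma mulA_single (b b' : Bas) :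
    mulA (Finsupp.single b 1) (Finsupp.single b' 1) = mulB b b' := by
  simp [mulA]

lemma one_add_one_zmod : (1 : ZMod 2) + 1 = 0 := by decide

lemma rep_mulB_inl_inl {s : ℂ} (hs : s * s = 1) (a b : K) :
    rep s (mulB (Sum.inl a) (Sum.inl b)) = repBasis s (Sum.inl a) * repBasis s (Sum.inl b) := by
  simp only [mulB, rep_u]
  revert a b
  refine forall_K ?_ ?_ ?_ ?_ <;> refine forall_K ?_ ?_ ?_ ?_ <;>
    simp [repBasis, Z, one_add_one_zmod, hs, Matrix.one_fin_two]

lemma rep_mulB_inl_inr {s : ℂ} (hs : s * s = 1) (a : K) (i j : Fin 2) :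
    rep s (mulB (Sum.inl a) (Sum.inr (i, j))) =
      repBasis s (Sum.inl a) * repBasis s (Sum.inr (i, j)) := by
  revert a
  refine forall_K ?_ ?_ ?_ ?_ <;> fin_cases i <;> fin_cases j <;>
    simp [mulB, rep_v, repBasis, P, X, Y, Z, hs, Matrix.one_fin_two]

lemma rep_mulB_inr_inl {s : ℂ} (hs : s * s = 1) (a : K) (i j : Fin 2) :
    rep s (mulB (Sum.inr (i, j)) (Sum.inl a)) =
      repBasis s (Sum.inr (i, j)) * repBasis s (Sum.inl a) := by
  revert a
  refine forall_K ?_ ?_ ?_ ?_ <;> fin_cases i <;> fin_cases j <;>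
    simp [mulB, rep_v, repBasis, eps, P, X, Y, Z, hs, Matrix.one_fin_two]

lemma rep_mulB_inr_inr {s : ℂ} (hs : s * s = 1) (i j k l : Fin 2) :
    rep s (mulB (Sum.inr (i, j)) (Sum.inr (k, l))) =
      repBasis s (Sum.inr (i, j)) * repBasis s (Sum.inr (k, l)) := by
  have hI : Complex.I / 2 * Complex.I = -(1 / 2) := by
    linear_combination (1 / 2 : ℂ) * Complex.I_mul_I
  fin_cases i <;> fin_cases j <;> fin_cases k <;> fin_cases l <;>
    ext a b <;> fin_cases a <;> fin_cases b <;>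
    simp [mulB, rep_u, repBasis, X, Y, Z, hs, hI] <;> ring

lemma rep_mulA {s : ℂ} (hs : s * s = 1) (x y : B) : rep s (mulA x y) = rep s x * rep s y := by
  have h : ∀ b b', rep s (mulB b b') = repBasis s b * repBasis s b' := by
    rintro (a | ⟨i, j⟩) (b | ⟨k, l⟩)
    · exact rep_mulB_inl_inl hs a b
    · exact rep_mulB_inl_inr hs a k l
    · exact rep_mulB_inr_inl hs b i j
    · exact rep_mulB_inr_inr hs i j k l
  simp only [mulA_eq_sum, map_sum, map_smul, h, rep_apply s x, rep_apply s y, Finset.sum_mul_sum,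
    smul_mul_smul_comm]

lemma rep_eq_fin_two (s : ℂ) (x : B) :
    rep s x =
      !![x (Sum.inl (0, 0)) + x (Sum.inl (0, 1)) + s * (x (Sum.inl (1, 0)) + x (Sum.inl (1, 1))),
          x (Sum.inr (0, 0)) + s * x (Sum.inr (1, 1));
        x (Sum.inr (1, 0)) - s * x (Sum.inr (0, 1)),
          x (Sum.inl (0, 0)) - x (Sum.inl (0, 1)) -
            s * (x (Sum.inl (1, 0)) - x (Sum.inl (1, 1)))] := by
  rw [rep_apply, Fintype.sum_sum_type, sum_K, Fintype.sum_prod_type]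
  ext i j
  fin_cases i <;> fin_cases j <;> simp [repBasis, Z] <;> ring

/-- The product of the two representations of `B`. -/
def toProd : B →ₗ[ℂ] Matrix (Fin 2) (Fin 2) ℂ × Matrix (Fin 2) (Fin 2) ℂ :=
  (rep 1).prod (rep (-1))

lemma toProd_mulA (x y : B) : toProd (mulA x y) = toProd x * toProd y :=
  Prod.ext (rep_mulA (by norm_num) x y) (rep_mulA (by norm_num) x y)

lemma toProd_u_zero : toProd (u (0, 0)) = 1 := by
  simp [toProd, rep_u, repBasis, Prod.one_eq_mk]

lemma toProd_injective : Function.Injective toProd := by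
  rw [injective_iff_map_eq_zero]
  intro x hx
  have h₁ : rep 1 x = 0 := congrArg Prod.fst hx
  have h₂ : rep (-1) x = 0 := congrArg Prod.snd hx
  rw [rep_eq_fin_two, ← Matrix.ext_iff] at h₁ h₂
  simp only [Fin.forall_fin_two, Matrix.of_apply, Matrix.cons_val', Matrix.cons_val_zero,
    Matrix.cons_val_one, Matrix.cons_val_fin_one, Matrix.zero_apply] at h₁ h₂
  obtain ⟨⟨p₁, p₂⟩, p₃, p₄⟩ := h₁
  obtain ⟨⟨q₁, q₂⟩, q₃, q₄⟩ := h₂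
  ext b
  rcases b with a | ⟨i, j⟩
  · revert a
    refine forall_K ?_ ?_ ?_ ?_ <;> simp only [Finsupp.coe_zero, Pi.zero_apply]
    · linear_combination (p₁ + p₄ + q₁ + q₄) / 4
    · linear_combination (p₁ - p₄ + q₁ - q₄) / 4
    · linear_combination (p₁ - p₄ - q₁ + q₄) / 4
    · linear_combination (p₁ + p₄ - q₁ - q₄) / 4
  · fin_cases i <;> fin_cases j <;>
      simp only [Finsupp.coe_zero, Pi.zero_apply, Fin.zero_eta, Fin.mk_one]
    · linear_combination (p₂ + q₂) / 2
    · linear_combination (q₃ - p₃) / 2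
    · linear_combination (p₃ + q₃) / 2
    · linear_combination (p₂ - q₂) / 2

/-- `B` is isomorphic to `M₂(ℂ) × M₂(ℂ)`. -/
def equivProd : B ≃ₗ[ℂ] Matrix (Fin 2) (Fin 2) ℂ × Matrix (Fin 2) (Fin 2) ℂ :=
  toProd.linearEquivOfInjective toProd_injective (by simp [Module.finrank_matrix])

lemma u_mul_v (i j : Fin 2) : mulA (u (0, 1)) (v i j) = -mulA (v i j) (u (0, 1)) := by
  simp [u, v, mulA_single, mulB, eps]
  abel

lemma v_mul_v_fst : mulA (v 0 0) (v 1 0) = (1 / 2 : ℂ) • (u (0, 0) + u (0, 1)) := by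
  have hI : Complex.I / 2 * Complex.I = -(1 / 2) := by
    linear_combination (1 / 2 : ℂ) * Complex.I_mul_I
  rw [v, v, mulA_single]
  simp [mulB, X, Y, Z, hI]

lemma v_mul_v_snd : mulA (v 0 1) (v 1 1) = (1 / 2 : ℂ) • (u (0, 1) - u (0, 0)) := by
  have hI : Complex.I / 2 * Complex.I = -(1 / 2) := by
    linear_combination (1 / 2 : ℂ) * Complex.I_mul_I
  rw [v, v, mulA_single]
  simp [mulB, X, Y, Z, hI, smul_sub]
  abel

lemma not_exists_character :
    ¬ ∃ φ : B →ₗ[ℂ] ℂ, (∀ x y : B, φ (mulA x y) = φ x * φ y) ∧ φ (u (0, 0)) = 1 := by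
  rintro ⟨φ, hφ, h1⟩
  have hu : φ (u (0, 1)) * φ (u (0, 1)) = 1 := by
    rw [← hφ, ← h1, u, mulA_single]
    rfl
  have hv (i j : Fin 2) : φ (v i j) = 0 := by
    have h := congrArg φ (u_mul_v i j)
    rw [map_neg, hφ, hφ] at h
    linear_combination φ (u (0, 1)) / 2 * h - φ (v i j) * hu
  have h₂ := congrArg φ v_mul_v_fst
  have h₃ := congrArg φ v_mul_v_snd
  simp only [hφ, hv, map_smul, map_add, map_sub, h1, smul_eq_mul] at h₂ h₃
  exact one_ne_zero (α := ℂ) (by linear_combination h₃ - h₂)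

/-- The multiplication of `B` is associative with two-sided unit
`u_{(0,0)}`, `B` is isomorphic as a ℂ-algebra to `M₂(ℂ) × M₂(ℂ)`, and consequently `B`
admits no unital ℂ-algebra homomorphism to `ℂ`. -/
theorem nu1_nu2_interface_algebra :
    (∀ x y z : B, mulA (mulA x y) z = mulA x (mulA y z)) ∧
    (∀ x : B, mulA (u (0, 0)) x = x ∧ mulA x (u (0, 0)) = x) ∧
    (∃ f : B ≃ₗ[ℂ] (Matrix (Fin 2) (Fin 2) ℂ × Matrix (Fin 2) (Fin 2) ℂ),
        (∀ x y : B, f (mulA x y) = f x * f y) ∧ f (u (0, 0)) = 1) ∧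
    ¬ ∃ φ : B →ₗ[ℂ] ℂ, (∀ x y : B, φ (mulA x y) = φ x * φ y) ∧ φ (u (0, 0)) = 1 := by
  refine ⟨fun x y z => toProd_injective ?_,
    fun x => ⟨toProd_injective ?_, toProd_injective ?_⟩,
    ⟨equivProd, toProd_mulA, toProd_u_zero⟩, not_exists_character⟩
  · simp only [toProd_mulA, mul_assoc]
  · rw [toProd_mulA, toProd_u_zero, one_mul]
  · rw [toProd_mulA, toProd_u_zero, mul_one]

end RepD8InterfaceNu1Nu2
end
end

section
/- Let B' be the 8-dimensional ℂ-vector space with basis {u_a : a ∈ K} ∪ {v_{ij} : i,j ∈ {1,2}}, equipped with the ℂ-bilinear multiplication determined by: u_a·u_b = u_{a+b}; u_a·v_{ij} = Σ_{k,l} (P_a)_{ik}(P_a)_{lj} v_{kl}; v_{ij}·u_a = ε'(a)·Σ_{k,l} (P_a)_{ik}(P_a)_{lj} v_{kl}, where ε'(0,0) = ε'(0,1) = 1 and ε'(1,0) = ε'(1,1) = −1; and v_{ij}·v_{kl} = (1/2)Z_{ik}δ_{jl}·u_{(0,0)} + (1/2)δ_{ik}Z_{jl}·u_{(0,1)} −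 (i/2)Y_{ik}X_{jl}·u_{(1,0)} − (i/2)X_{ik}Y_{jl}·u_{(1,1)}. Then this multiplication is associative with two-sided unit u_{(0,0)}, and B' is isomorphic as a ℂ-algebra to M₂(ℂ) × M₂(ℂ); consequently B' admits no unital ℂ-algebra homomorphism to ℂ. (B' is the interface algebra between the distinct Rep(D₈) SPT phases ν₂ and ν₃.) -/
noncomputable section

namespace RepD8InterfaceNu2Nu3

/-- `K = ℤ/2 × ℤ/2`. -/
abbrev K : Type := ZMod 2 × ZMod 2

/-- Basis of the interface algebra: `u_a` for `a ∈ K` and `v_{ij}` for `i,j ∈ {1,2}`. -/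
abbrev Bas : Type := K ⊕ (Fin 2 × Fin 2)

/-- The underlying 8-dimensional ℂ-vector space. -/
abbrev B' : Type := Bas →₀ ℂ

/-- Basis vector `u_a`. -/
def u (a : K) : B' := Finsupp.single (Sum.inl a) 1

/-- Basis vector `v_{ij}`. -/
def v (i j : Fin 2) : B' := Finsupp.single (Sum.inr (i, j)) 1

/-- Pauli matrix `X`. -/
def X : Matrix (Fin 2) (Fin 2) ℂ := !![0, 1; 1, 0]

/-- Pauli matrix `Y`. -/
def Y : Matrix (Fin 2) (Fin 2) ℂ := !![0, -Complex.I; Complex.I, 0]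

/-- Pauli matrix `Z`. -/
def Z : Matrix (Fin 2) (Fin 2) ℂ := !![1, 0; 0, -1]

/-- `P_{(0,0)} = I₂`, `P_{(0,1)} = Z`, `P_{(1,0)} = X`, `P_{(1,1)} = Y`. -/
def P : K → Matrix (Fin 2) (Fin 2) ℂ := fun a =>
  if a = (0, 0) then 1 else if a = (0, 1) then Z else if a = (1, 0) then X else Y

/-- The sign `ε'` with `ε'(0,0) = ε'(0,1) = 1` and `ε'(1,0) = ε'(1,1) = −1`. -/
def eps' : K → ℂ := fun a => if a = (0, 0) ∨ a = (0, 1) then 1 else -1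

/-- Structure constants of the algebra `B'` (the interface algebra between the distinct
`Rep(D₈)` SPT phases `ν₂` and `ν₃`):
`u_a·u_b = u_{a+b}`;
`u_a·v_{ij} = Σ_{k,l} (P_a)_{ik}(P_a)_{lj} v_{kl}`;
`v_{ij}·u_a = ε'(a)·Σ_{k,l} (P_a)_{ik}(P_a)_{lj} v_{kl}`;
`v_{ij}·v_{kl} = ½Z_{ik}δ_{jl}·u_{(0,0)} + ½δ_{ik}Z_{jl}·u_{(0,1)}
  − (i/2)Y_{ik}X_{jl}·u_{(1,0)} − (i/2)X_{ik}Y_{jl}·u_{(1,1)}`. -/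
def mulB : Bas → Bas → B'
  | Sum.inl a, Sum.inl b => u (a + b)
  | Sum.inl a, Sum.inr (i, j) => ∑ k : Fin 2, ∑ l : Fin 2, (P a i k * P a l j) • v k l
  | Sum.inr (i, j), Sum.inl a =>
      ∑ k : Fin 2, ∑ l : Fin 2, (eps' a * (P a i k * P a l j)) • v k l
  | Sum.inr (i, j), Sum.inr (k, l) =>
      ((1 : ℂ) / 2 * (Z i k * (if j = l then (1 : ℂ) else 0))) • u (0, 0)
        + ((1 : ℂ) / 2 * ((if i = k then (1 : ℂ) else 0) * Z j l)) • u (0, 1)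
        - (Complex.I / 2 * (Y i k * X j l)) • u (1, 0)
        - (Complex.I / 2 * (X i k * Y j l)) • u (1, 1)

/-- The ℂ-bilinear multiplication of `B'` determined by the structure constants. -/
def mulA (x y : B') : B' :=
  x.sum fun b c => y.sum fun b' c' => (c * c') • mulB b b'

/-- The images of the basis vectors in `M₂(ℂ) × M₂(ℂ)`: `u_a` acts diagonally through characters
of `K`, and `v_{ij}` acts off-diagonally through entries of Pauli matrices. -/
def basisImage : Bas → Matrix (Fin 2) (Fin 2) ℂ × Matrix (Fin 2) (Fin 2) ℂ
  | Sum.inl a =>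
      if a = (0, 0) then (1, 1) else if a = (0, 1) then (1, -1)
      else if a = (1, 0) then (Z, Z) else (Z, -Z)
  | Sum.inr (i, j) =>
      (!![0, if i = j then 1 else 0; Z i j, 0], !![0, X i j; Complex.I * Y i j, 0])

/-- The linear extension of `basisImage`. -/
def toMatrices : B' →ₗ[ℂ] Matrix (Fin 2) (Fin 2) ℂ × Matrix (Fin 2) (Fin 2) ℂ :=
  Finsupp.linearCombination ℂ basisImage

/-- The inverse of `toMatrices`. -/
def ofMatrices (m : Matrix (Fin 2) (Fin 2) ℂ × Matrix (Fin 2) (Fin 2) ℂ) : B' :=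
  ((m.1 0 0 + m.1 1 1 + m.2 0 0 + m.2 1 1) / 4) • u (0, 0)
    + ((m.1 0 0 + m.1 1 1 - m.2 0 0 - m.2 1 1) / 4) • u (0, 1)
    + ((m.1 0 0 - m.1 1 1 + m.2 0 0 - m.2 1 1) / 4) • u (1, 0)
    + ((m.1 0 0 - m.1 1 1 - m.2 0 0 + m.2 1 1) / 4) • u (1, 1)
    + ((m.1 0 1 + m.1 1 0) / 2) • v 0 0 + ((m.1 0 1 - m.1 1 0) / 2) • v 1 1
    + ((m.2 0 1 + m.2 1 0) / 2) • v 0 1 + ((m.2 0 1 - m.2 1 0) / 2) • v 1 0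

lemma K_cases (a : K) : a = (0, 0) ∨ a = (0, 1) ∨ a = (1, 0) ∨ a = (1, 1) := by
  revert a; decide

@[simp] lemma toMatrices_u (a : K) : toMatrices (u a) = basisImage (Sum.inl a) := by
  simp [toMatrices, u]

@[simp] lemma toMatrices_v (i j : Fin 2) : toMatrices (v i j) = basisImage (Sum.inr (i, j)) := by
  simp [toMatrices, v]

lemma toMatrices_ofMatrices (m : Matrix (Fin 2) (Fin 2) ℂ × Matrix (Fin 2) (Fin 2) ℂ) :
    toMatrices (ofMatrices m) = m := by
  simp only [ofMatrices, map_add, map_smul, toMatrices_u, toMatrices_v]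
  ext i j <;> fin_cases i <;> fin_cases j <;>
    simp [basisImage, X, Y, Z] <;> ring

lemma toMatrices_bijective : Function.Bijective toMatrices := by
  have hs : Function.Surjective toMatrices := fun m => ⟨_, toMatrices_ofMatrices m⟩
  refine ⟨(LinearMap.injective_iff_surjective_of_finrank_eq_finrank ?_).2 hs, hs⟩
  simp [Module.finrank_matrix]

lemma toMatrices_mulB (b b' : Bas) :
    toMatrices (mulB b b') = basisImage b * basisImage b' := by
  rcases b with a | ⟨i, j⟩ <;> rcases b' with a' | ⟨k, l⟩
  · have h : (1 : ZMod 2) + 1 = 0 := by decide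
    rcases K_cases a with rfl | rfl | rfl | rfl <;>
      rcases K_cases a' with rfl | rfl | rfl | rfl <;>
      simp [mulB, basisImage, h, Z, Matrix.one_fin_two]
  · rcases K_cases a with rfl | rfl | rfl | rfl <;> fin_cases k <;> fin_cases l <;>
      simp [mulB, basisImage, P, X, Y, Z, Matrix.one_fin_two]
  · rcases K_cases a' with rfl | rfl | rfl | rfl <;> fin_cases i <;> fin_cases j <;>
      simp [mulB, basisImage, P, eps', X, Y, Z, Matrix.one_fin_two]
  · fin_cases i <;> fin_cases j <;> fin_cases k <;> fin_cases l <;>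
      simp [mulB, basisImage, X, Y, Z, Prod.ext_iff, ← Matrix.ext_iff] <;> ring_nf <;>
      simp [funext_iff]

lemma toMatrices_mulA (x y : B') : toMatrices (mulA x y) = toMatrices x * toMatrices y := by
  have h (z : B') : toMatrices z = z.sum fun b c => c • basisImage b :=
    Finsupp.linearCombination_apply ℂ z
  rw [h x, h y, mulA, Finsupp.sum_mul, map_finsuppSum]
  refine Finsupp.sum_congr fun b _ => ?_
  rw [Finsupp.mul_sum, map_finsuppSum]
  refine Finsupp.sum_congr fun b' _ => ?_
  rw [map_smul, toMatrices_mulB, smul_mul_smul_comm]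

lemma toMatrices_one : toMatrices (u (0, 0)) = 1 := by
  simp [basisImage]

lemma mulA_single (b b' : Bas) :
    mulA (Finsupp.single b 1) (Finsupp.single b' 1) = mulB b b' := by
  simp [mulA]

lemma mulA_v_u_one_zero (i j : Fin 2) : mulA (v i j) (u (1, 0)) = -mulA (u (1, 0)) (v i j) := by
  simp [u, v, mulA_single, mulB, eps', add_comm]

lemma u_zero_eq_sum_sq : u (0, 0) = mulA (v 0 0) (v 0 0) + mulA (v 0 1) (v 0 1) := by
  apply toMatrices_bijective.1
  simp only [map_add, toMatrices_mulA, toMatrices_u, toMatrices_v]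
  simp [basisImage, X, Y, Z, Matrix.one_fin_two]


/-- The multiplication of `B'` is associative with two-sided unit
`u_{(0,0)}`, `B'` is isomorphic as a ℂ-algebra to `M₂(ℂ) × M₂(ℂ)`, and consequently
`B'` admits no unital ℂ-algebra homomorphism to `ℂ`. -/
theorem nu2_nu3_interface_algebra :
    (∀ x y z : B', mulA (mulA x y) z = mulA x (mulA y z)) ∧
    (∀ x : B', mulA (u (0, 0)) x = x ∧ mulA x (u (0, 0)) = x) ∧
    (∃ f : B' ≃ₗ[ℂ] (Matrix (Fin 2) (Fin 2) ℂ × Matrix (Fin 2) (Fin 2) ℂ),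
        (∀ x y : B', f (mulA x y) = f x * f y) ∧ f (u (0, 0)) = 1) ∧
    ¬ ∃ φ : B' →ₗ[ℂ] ℂ, (∀ x y : B', φ (mulA x y) = φ x * φ y) ∧ φ (u (0, 0)) = 1 := by
  have hinj := toMatrices_bijective.1
  refine ⟨fun x y z => hinj ?_, fun x => ⟨hinj ?_, hinj ?_⟩,
    ⟨LinearEquiv.ofBijective toMatrices toMatrices_bijective, toMatrices_mulA, toMatrices_one⟩, ?_⟩
  · simp only [toMatrices_mulA, mul_assoc]
  · rw [toMatrices_mulA, toMatrices_one, one_mul]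
  · rw [toMatrices_mulA, toMatrices_one, mul_one]
  · rintro ⟨φ, hφ, h1⟩
    have hu : φ (u (1, 0)) * φ (u (1, 0)) = 1 := by
      rw [← hφ, ← h1, u, mulA_single]
      rfl
    have hu0 : φ (u (1, 0)) ≠ 0 := fun h => by simp [h] at hu
    have hv (i j : Fin 2) : φ (v i j) = 0 := by
      have h := congrArg φ (mulA_v_u_one_zero i j)
      rw [map_neg, hφ, hφ, mul_comm, self_eq_neg] at h
      exact (mul_eq_zero.1 h).resolve_left hu0
    have h := congrArg φ u_zero_eq_sum_sq
    rw [map_add, hφ, hφ, hv, hv, h1] at h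
    simp at h

end RepD8InterfaceNu2Nu3
end
end

section
/- Let C be the 8-dimensional ℂ-vector space with basis {u_a : a ∈ K} ∪ {v_{ij} : i,j ∈ {1,2}}, equipped with the ℂ-bilinear multiplication determined by: u_a·u_b = u_{a+b}; u_a·v_{ij} = v_{ij}·u_a = Σ_{k,l} (P_a)_{ik}(P_a)_{lj} v_{kl}; and v_{ij}·v_{kl} = −(1/2)Y_{ik}Y_{jl}·u_{(0,0)} + (1/2)X_{ik}X_{jl}·u_{(0,1)} + (1/2)Z_{ik}Z_{jl}·u_{(1,0)} + (1/2)δ_{ik}δ_{jl}·u_{(1,1)}. Then this multiplication is associative with two-sided unit u_{(0,0)}, C is commutative, and C is isomorphic as a ℂ-algebra to ℂ⁸ (the product of eight copies of ℂ); in particular C has exactly eight unital ℂ-algebra homomorphisms to ℂ. (C is the self-interface algebra of the unique Rep(Q₈) SPT phase.) -/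
noncomputable section

namespace RepQ8Interface

/-- `K = ℤ/2 × ℤ/2`. -/
abbrev K : Type := ZMod 2 × ZMod 2

/-- Basis of the interface algebra: `u_a` for `a ∈ K` and `v_{ij}` for `i,j ∈ {1,2}`. -/
abbrev Bas : Type := K ⊕ (Fin 2 × Fin 2)

/-- The underlying 8-dimensional ℂ-vector space. -/
abbrev C' : Type := Bas →₀ ℂ

/-- Basis vector `u_a`. -/
def u (a : K) : C' := Finsupp.single (Sum.inl a) 1

/-- Basis vector `v_{ij}`. -/
def v (i j : Fin 2) : C' := Finsupp.single (Sum.inr (i, j)) 1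

/-- Pauli matrix `X`. -/
def X : Matrix (Fin 2) (Fin 2) ℂ := !![0, 1; 1, 0]

/-- Pauli matrix `Y`. -/
def Y : Matrix (Fin 2) (Fin 2) ℂ := !![0, -Complex.I; Complex.I, 0]

/-- Pauli matrix `Z`. -/
def Z : Matrix (Fin 2) (Fin 2) ℂ := !![1, 0; 0, -1]

/-- `P_{(0,0)} = I₂`, `P_{(0,1)} = Z`, `P_{(1,0)} = X`, `P_{(1,1)} = Y`. -/
def P : K → Matrix (Fin 2) (Fin 2) ℂ := fun a =>
  if a = (0, 0) then 1 else if a = (0, 1) then Z else if a = (1, 0) then X else Y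

/-- Structure constants of the algebra `C` (the self-interface algebra of the unique
`Rep(Q₈)` SPT phase):
`u_a·u_b = u_{a+b}`;
`u_a·v_{ij} = v_{ij}·u_a = Σ_{k,l} (P_a)_{ik}(P_a)_{lj} v_{kl}`;
`v_{ij}·v_{kl} = −½Y_{ik}Y_{jl}·u_{(0,0)} + ½X_{ik}X_{jl}·u_{(0,1)}
  + ½Z_{ik}Z_{jl}·u_{(1,0)} + ½δ_{ik}δ_{jl}·u_{(1,1)}`. -/
def mulB : Bas → Bas → C'
  | Sum.inl a, Sum.inl b => u (a + b)
  | Sum.inl a, Sum.inr (i, j) => ∑ k : Fin 2, ∑ l : Fin 2, (P a i k * P a l j) • v k l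
  | Sum.inr (i, j), Sum.inl a => ∑ k : Fin 2, ∑ l : Fin 2, (P a i k * P a l j) • v k l
  | Sum.inr (i, j), Sum.inr (k, l) =>
      -(((1 : ℂ) / 2 * (Y i k * Y j l)) • u (0, 0))
        + ((1 : ℂ) / 2 * (X i k * X j l)) • u (0, 1)
        + ((1 : ℂ) / 2 * (Z i k * Z j l)) • u (1, 0)
        + ((1 : ℂ) / 2 * ((if i = k then (1 : ℂ) else 0) * (if j = l then (1 : ℂ) else 0))) • u (1, 1)

/-- The ℂ-bilinear multiplication of `C` determined by the structure constants. -/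
def mulA (x y : C') : C' :=
  x.sum fun b c => y.sum fun b' c' => (c * c') • mulB b b'

@[elab_as_elim]
lemma K_cases {p : K → Prop} (a : K) (h00 : p (0, 0)) (h01 : p (0, 1)) (h10 : p (1, 0))
    (h11 : p (1, 1)) : p a := by
  obtain ⟨a, b⟩ := a
  fin_cases a <;> fin_cases b <;> assumption

lemma sum_K (g : K → ℂ) : ∑ a, g a = g (0, 0) + g (0, 1) + g (1, 0) + g (1, 1) := by
  rw [Fintype.sum_prod_type, show (Finset.univ : Finset (ZMod 2)) = {0, 1} from rfl]
  simp [add_assoc]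

lemma P_00 : P (0, 0) = 1 := by simp [P]
lemma P_01 : P (0, 1) = Z := by simp [P]
lemma P_10 : P (1, 0) = X := by simp [P]
lemma P_11 : P (1, 1) = Y := by simp [P]

/-- The sign `±1` with `P a * P b * P a = χ b a • P b`. -/
def χ (b a : K) : ℂ := (-1) ^ (b.1 * a.2 + b.2 * a.1).val

/-- Values on the basis of the eight characters of `C`, indexed by a Pauli matrix and a sign. -/
def charValue (m : K × Fin 2) : Bas → ℂ
  | Sum.inl a => χ m.1 a
  | Sum.inr (i, j) => (-1) ^ m.2.val * (if m.1 = 0 then 1 else Complex.I) * P m.1 i j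

/-- The eight characters of `C`, extended linearly from the basis. -/
def char (m : K × Fin 2) : C' →ₗ[ℂ] ℂ := Finsupp.linearCombination ℂ (charValue m)

lemma char_single (m : K × Fin 2) (b : Bas) (c : ℂ) :
    char m (Finsupp.single b c) = c * charValue m b := by
  simp [char]

lemma char_u (m : K × Fin 2) (a : K) : char m (u a) = χ m.1 a := by
  simp [u, char_single, charValue]

lemma char_v (m : K × Fin 2) (i j : Fin 2) :
    char m (v i j) = (-1) ^ m.2.val * (if m.1 = 0 then 1 else Complex.I) * P m.1 i j := by
  simp [v, char_single, charValue]

lemma χ_add (b a a' : K) : χ b (a + a') = χ b a * χ b a' := by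
  have h (s t : ZMod 2) : (-1 : ℂ) ^ (s + t).val = (-1) ^ s.val * (-1) ^ t.val := by
    rw [ZMod.val_add, ← pow_add, neg_one_pow_eq_pow_mod_two (n := s.val + t.val)]
  rw [χ, χ, χ, ← h]
  congr 2
  simp only [Prod.fst_add, Prod.snd_add]
  ring

lemma χ_values (b : K) : χ b (0, 0) = 1 ∧ χ b (0, 1) = (-1) ^ b.1.val ∧
    χ b (1, 0) = (-1) ^ b.2.val ∧ χ b (1, 1) = (-1) ^ b.1.val * (-1) ^ b.2.val := by
  refine ⟨by simp [χ], by simp [χ], by simp [χ], ?_⟩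
  rw [show ((1, 1) : K) = (0, 1) + (1, 0) from rfl, χ_add]
  simp [χ]

lemma P_conj (b a : K) (i j : Fin 2) :
    ∑ k : Fin 2, ∑ l : Fin 2, P a i k * P a l j * P b k l = χ b a * P b i j := by
  obtain ⟨h00, h01, h10, h11⟩ := χ_values b
  induction a using K_cases <;> induction b using K_cases <;>
    simp only [h00, h01, h10, h11, P_00, P_01, P_10, P_11] <;>
    fin_cases i <;> fin_cases j <;> simp [X, Y, Z, ZMod.val_one, Matrix.one_apply]

/-- The Fierz-type identity expanding a product of two entries of a Pauli matrix. -/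
lemma P_mul_P (b : K) (i j k l : Fin 2) :
    (if b = 0 then 1 else Complex.I) ^ 2 * (P b i j * P b k l) =
      1 / 2 * (-(χ b (0, 0) * (Y i k * Y j l)) + χ b (0, 1) * (X i k * X j l) +
        χ b (1, 0) * (Z i k * Z j l) +
        χ b (1, 1) * ((if i = k then 1 else 0) * (if j = l then 1 else 0))) := by
  obtain ⟨h00, h01, h10, h11⟩ := χ_values b
  rw [h00, h01, h10, h11]
  induction b using K_cases <;> simp only [P_00, P_01, P_10, P_11] <;>
    fin_cases i <;> fin_cases j <;> fin_cases k <;> fin_cases l <;>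
    norm_num [X, Y, Z, ZMod.val_one, Matrix.one_apply]

lemma char_mulB (m : K × Fin 2) (b b' : Bas) :
    char m (mulB b b') = charValue m b * charValue m b' := by
  have conj (a : K) (i j : Fin 2) :
      char m (∑ k : Fin 2, ∑ l : Fin 2, (P a i k * P a l j) • v k l) =
        charValue m (Sum.inl a) * charValue m (Sum.inr (i, j)) := by
    have h := P_conj m.1 a i j
    simp only [Fin.sum_univ_two] at h
    simp only [Fin.sum_univ_two, map_add, map_smul, char_v, smul_eq_mul, charValue]
    linear_combination ((-1) ^ m.2.val * (if m.1 = 0 then 1 else Complex.I)) * h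
  rcases b with a | ⟨i, j⟩ <;> rcases b' with a' | ⟨k, l⟩
  · simp [mulB, char_u, charValue, χ_add]
  · exact conj a k l
  · rw [mul_comm]
    exact conj a' i j
  · have hs : ((-1 : ℂ) ^ m.2.val) ^ 2 = 1 := by rw [← pow_mul, mul_comm, pow_mul]; simp
    have h := P_mul_P m.1 i j k l
    simp only [mulB, map_add, map_neg, map_smul, char_u, smul_eq_mul, charValue]
    linear_combination -h - (if m.1 = 0 then 1 else Complex.I) ^ 2 *
      (P m.1 i j * P m.1 k l) * hs

lemma char_mulA (m : K × Fin 2) (x y : C') : char m (mulA x y) = char m x * char m y := by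
  simp only [mulA, map_finsuppSum, map_smul, char_mulB]
  simp only [char, Finsupp.linearCombination_apply, Finsupp.sum_mul, Finsupp.mul_sum, smul_eq_mul]
  rw [Finsupp.sum_comm]
  refine Finsupp.sum_congr fun b _ => Finsupp.sum_congr fun b' _ => ?_
  ring

lemma char_unit (m : K × Fin 2) : char m (u (0, 0)) = 1 := by
  simp [char_u, χ]

/-- The joint evaluation of all characters. -/
def charMap : C' →ₗ[ℂ] (K × Fin 2 → ℂ) := LinearMap.pi char

lemma charMap_injective : Function.Injective charMap := by
  rw [injective_iff_map_eq_zero]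
  intro x hx
  have h (m : K × Fin 2) : ∑ b : Bas, x b * charValue m b = 0 := by
    have := congrFun hx m
    simpa [charMap, char, Finsupp.linearCombination_apply, Finsupp.sum_fintype] using this
  have hu (b : K) : ∑ a : K, x (Sum.inl a) * χ b a = 0 := by
    have h0 := h (b, 0)
    have h1 := h (b, 1)
    simp only [Fintype.sum_sum_type, Fintype.sum_prod_type, Fin.sum_univ_two, charValue] at h0 h1 ⊢
    simp only [Fin.val_zero, Fin.val_one, pow_zero, pow_one] at h0 h1
    linear_combination (h0 + h1) / 2
  have hv (b : K) : ∑ q : Fin 2 × Fin 2, x (Sum.inr q) * P b q.1 q.2 = 0 := by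
    have h0 := h (b, 0)
    rw [Fintype.sum_sum_type] at h0
    simp only [charValue, hu, zero_add] at h0
    have hc : (if b = 0 then 1 else Complex.I) ≠ 0 := by split_ifs <;> simp
    refine (mul_eq_zero.mp ?_).resolve_left hc
    rw [← h0, Finset.mul_sum]
    refine Finset.sum_congr rfl fun q _ => ?_
    simp only [Fin.val_zero, pow_zero]
    ring
  have e0 := hu (0, 0)
  have e1 := hu (0, 1)
  have e2 := hu (1, 0)
  have e3 := hu (1, 1)
  have f0 := hv (0, 0)
  have f1 := hv (0, 1)
  have f2 := hv (1, 0)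
  have f3 := hv (1, 1)
  simp only [sum_K, χ_values, ZMod.val_zero, ZMod.val_one] at e0 e1 e2 e3
  norm_num at e0 e1 e2 e3
  simp [Fintype.sum_prod_type, P_00, P_01, P_10, P_11, X, Y, Z] at f0 f1 f2 f3
  ext (a | ⟨i, j⟩)
  · induction a using K_cases <;> simp only [Finsupp.coe_zero, Pi.zero_apply]
    · linear_combination (e0 + e1 + e2 + e3) / 4
    · linear_combination (e0 + e1 - e2 - e3) / 4
    · linear_combination (e0 - e1 + e2 - e3) / 4
    · linear_combination (e0 - e1 - e2 + e3) / 4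
  · fin_cases i <;> fin_cases j <;> simp
    · linear_combination (f0 + f1) / 2
    · linear_combination (f2 + Complex.I * f3) / 2 +
        (x (Sum.inr (0, 1)) - x (Sum.inr (1, 0))) * Complex.I_sq / 2
    · linear_combination (f2 - Complex.I * f3) / 2 +
        (x (Sum.inr (1, 0)) - x (Sum.inr (0, 1))) * Complex.I_sq / 2
    · linear_combination (f0 - f1) / 2

/-- `C` is linearly isomorphic to `ℂ⁸` through its characters. -/
def charEquiv : C' ≃ₗ[ℂ] (Fin 8 → ℂ) :=
  (LinearEquiv.ofInjectiveOfFinrankEq charMap charMap_injective (by simp)).trans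
    (LinearEquiv.funCongrLeft ℂ ℂ (Fintype.equivFinOfCardEq (by simp)).symm)

lemma charEquiv_mulA (x y : C') : charEquiv (mulA x y) = charEquiv x * charEquiv y :=
  funext fun _ => char_mulA _ x y

lemma charEquiv_unit : charEquiv (u (0, 0)) = 1 :=
  funext fun _ => char_unit _

/-- A nonzero multiplicative functional on a finite power of a field is a coordinate. -/
lemma exists_eq_proj_of_mul {F ι : Type*} [Field F] [Fintype ι] (ψ : (ι → F) →ₗ[F] F)
    (hmul : ∀ x y, ψ (x * y) = ψ x * ψ y) (hone : ψ 1 = 1) :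
    ∃ i, ψ = LinearMap.proj i := by
  classical
  obtain ⟨i, hi⟩ : ∃ i, ψ (Pi.single i 1) ≠ 0 := by
    by_contra! h
    have : ψ = 0 := LinearMap.pi_ext' fun i => LinearMap.ext_ring (by simpa using h i)
    simp [this] at hone
  refine ⟨i, LinearMap.ext fun x => mul_right_cancel₀ hi ?_⟩
  have : x * Pi.single i 1 = x i • Pi.single i (1 : F) := by
    ext j
    by_cases hj : j = i
    · subst hj; simp
    · simp [hj]
  rw [← hmul, this, map_smul, smul_eq_mul, LinearMap.proj_apply]

/-- The multiplication of `C` is associative with two-sided unit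
`u_{(0,0)}`, `C` is commutative, `C` is isomorphic as a ℂ-algebra to `ℂ⁸` (the product
of eight copies of `ℂ`), and `C` has exactly eight unital ℂ-algebra homomorphisms
to `ℂ`. -/
theorem q8_self_interface_algebra :
    (∀ x y z : C', mulA (mulA x y) z = mulA x (mulA y z)) ∧
    (∀ x : C', mulA (u (0, 0)) x = x ∧ mulA x (u (0, 0)) = x) ∧
    (∀ x y : C', mulA x y = mulA y x) ∧
    (∃ f : C' ≃ₗ[ℂ] (Fin 8 → ℂ),
        (∀ x y : C', f (mulA x y) = f x * f y) ∧ f (u (0, 0)) = 1) ∧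
    Nat.card {φ : C' →ₗ[ℂ] ℂ //
        (∀ x y : C', φ (mulA x y) = φ x * φ y) ∧ φ (u (0, 0)) = 1} = 8 := by
  refine ⟨fun x y z => charEquiv.injective ?_, fun x => ⟨charEquiv.injective ?_,
    charEquiv.injective ?_⟩, fun x y => charEquiv.injective ?_,
    ⟨charEquiv, charEquiv_mulA, charEquiv_unit⟩, ?_⟩
  · simp only [charEquiv_mulA, mul_assoc]
  · rw [charEquiv_mulA, charEquiv_unit, one_mul]
  · rw [charEquiv_mulA, charEquiv_unit, mul_one]
  · rw [charEquiv_mulA, charEquiv_mulA, mul_comm]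
  · let g (i : Fin 8) : {φ : C' →ₗ[ℂ] ℂ //
        (∀ x y : C', φ (mulA x y) = φ x * φ y) ∧ φ (u (0, 0)) = 1} :=
      ⟨LinearMap.proj i ∘ₗ charEquiv.toLinearMap,
        fun x y => by simp [charEquiv_mulA], by simp [charEquiv_unit]⟩
    have hg : Function.Bijective g := by
      refine ⟨fun i j hij => ?_, fun ⟨φ, hmul, hone⟩ => ?_⟩
      · by_contra hne
        have h := LinearMap.congr_fun (congrArg Subtype.val hij)
          (charEquiv.symm (Pi.single i 1))
        simp [g, Pi.single_eq_of_ne' hne] at h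
      · obtain ⟨i, hi⟩ := exists_eq_proj_of_mul (φ ∘ₗ charEquiv.symm.toLinearMap)
          (fun x y => by
            have h := hmul (charEquiv.symm x) (charEquiv.symm y)
            rw [← charEquiv.symm_apply_apply (mulA _ _), charEquiv_mulA] at h
            simpa using h)
          (by simpa [← charEquiv_unit] using hone)
        refine ⟨i, Subtype.ext (LinearMap.ext fun x => ?_)⟩
        simpa [g] using (LinearMap.congr_fun hi (charEquiv x)).symm
    rw [← Nat.card_eq_of_bijective g hg, Nat.card_fin]

end RepQ8Interface
end
end
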